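/- For every n ≥ 2 and every nonzero integer k, the presented monoid B^{⊕k}(∞,∞,n) is cancellative: for all elements a, b, c, d, if a·b·d = a·c·d then b = c. -/

import Mathlib

/-- Index type for the generators `s̃_3, …, s̃_n`. -/
abbrev SIdx (n : ℕ) := {j : ℕ // 3 ≤ j ∧ j ≤ n}

/-- Generators of the Corran–Lee–Lee type presentations: `t̃_i` (`i ∈ ℤ`) and `s̃_j`
(`3 ≤ j ≤ n`). -/
abbrev Gen (n : ℕ) := ℤ ⊕ SIdx n

/-- The generator `t̃_i` as an element of the free monoid. -/
def tw (n : ℕ) (i : ℤ) : FreeMonoid (Gen n) := FreeMonoid.of (Sum.inl i)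

/-- The generator `s̃_j` as an element of the free monoid. -/
def sw (n : ℕ) (j : SIdx n) : FreeMonoid (Gen n) := FreeMonoid.of (Sum.inr j)

/-- The defining relations of the monoid `B^{⊕k}(∞,∞,n)`. -/
inductive BRel (n : ℕ) (k : ℤ) : FreeMonoid (Gen n) → FreeMonoid (Gen n) → Prop
  | braid (i j : SIdx n) (h : i.val + 1 = j.val ∨ j.val + 1 = i.val) :
      BRel n k (sw n i * sw n j * sw n i) (sw n j * sw n i * sw n j)
  | comm (i j : SIdx n) (h : i.val + 1 < j.val ∨ j.val + 1 < i.val) :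
      BRel n k (sw n i * sw n j) (sw n j * sw n i)
  | ts3 (i : ℤ) (s3 : SIdx n) (h : s3.val = 3) :
      BRel n k (sw n s3 * tw n i * sw n s3) (tw n i * sw n s3 * tw n i)
  | tsj (i : ℤ) (j : SIdx n) (h : 4 ≤ j.val) :
      BRel n k (sw n j * tw n i) (tw n i * sw n j)
  | tt (i j : ℤ) :
      BRel n k (tw n i * tw n (i - k)) (tw n j * tw n (j - k))

/-- The monoid `B^{⊕k}(∞,∞,n)`, presented by the generators `Gen n` and the relations
`BRel n k`. -/
abbrev BMon (n : ℕ) (k : ℤ) := (conGen (BRel n k)).Quotient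

/-- The image in `B^{⊕k}(∞,∞,n)` of a word in the generators. -/
def bmk (n : ℕ) (k : ℤ) : FreeMonoid (Gen n) →* BMon n k := (conGen (BRel n k)).mk'

section Words

variable {M : Type*} [Monoid M] {x y z a b c s : M}

theorem braid_mul (h : x * y * x = y * x * y) (p : M) :
    x * (y * (x * p)) = y * (x * (y * p)) := by
  simpa only [mul_assoc] using congrArg (· * p) h

theorem comm_mul (h : x * y = y * x) (p : M) : x * (y * p) = y * (x * p) :=
  Commute.left_comm h p

theorem word_braid_center (hxz : x * z * x = z * x * z) (hyz : y * z * y = z * y * z)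
    (hxy : x * y = y * x) : z * x * (y * z * x) = y * (z * y * x * z) := by
  have h : x * (z * x) = z * (x * z) := by simpa only [mul_assoc] using hxz
  simp only [mul_assoc]
  rw [comm_mul hxy, h, braid_mul hyz]

theorem word_braid_end_left (hxz : x * z * x = z * x * z) (hyz : y * z = z * y)
    (hxy : x * y * x = y * x * y) : z * x * (y * x * z) = y * x * (z * x * y) := by
  simp only [mul_assoc]
  rw [braid_mul hxy, comm_mul hyz.symm, hyz, braid_mul hxz]

theorem word_braid_end_right (hxz : x * z * x = z * x * z) (hyz : y * z = z * y)
    (hxy : x * y * x = y * x * y) : z * (x * y * (z * x)) = x * y * (z * x * y) := by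
  have h : x * (y * x) = y * (x * y) := by simpa only [mul_assoc] using hxy
  simp only [mul_assoc]
  rw [comm_mul hyz, ← braid_mul hxz, h, comm_mul hyz]

theorem word_twisted_braid (hab : a * b = b * c) (hb : b * s * b = s * b * s)
    (hc : c * s * c = s * c * s) : s * a * (b * s * c) = b * (s * (a * b) * s) := by
  have h : c * (s * c) = s * (c * s) := by simpa only [mul_assoc] using hc
  simp only [hab, mul_assoc]
  rw [← mul_assoc a b, hab, mul_assoc, h, braid_mul hb]

theorem word_twisted_square (hab : a * b = b * c) (hb : b * s * b = s * b * s) :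
    a * s * (b * s * c) = a * b * s * (a * b) := by
  simp only [hab, mul_assoc]
  rw [← braid_mul hb, ← mul_assoc a b, hab, mul_assoc]

end Words

section Complement

variable {α : Type*} {r : FreeMonoid α → FreeMonoid α → Prop} {C : α → α → FreeMonoid α}

/-- Every common right multiple `a * u = b * v` of `l`-value at most `N` is a right multiple of
`a * a'` via `u = a' * w` and `v = b' * w` with a common `w`. -/
def LcmUpTo {M : Type*} [Monoid M] (l : M → ℕ) (N : ℕ) (a b a' b' : M) : Prop :=
  ∀ u v, l (a * u) ≤ N → a * u = b * v → ∃ w, u = a' * w ∧ v = b' * w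

namespace LcmUpTo

variable {M : Type*} [Monoid M] {l : M → ℕ} {N : ℕ} {a b c a' b' c' a'' b'' : M}

theorem symm (h : LcmUpTo l N a b a' b') : LcmUpTo l N b a b' a' := by
  intro u v hl e
  obtain ⟨w, hu, hv⟩ := h v u (e ▸ hl) e.symm
  exact ⟨w, hv, hu⟩

theorem one_left (b : M) : LcmUpTo l N 1 b b 1 :=
  fun u v _ e => ⟨v, by simpa using e, by simp⟩

theorem one_right (a : M) : LcmUpTo l N a 1 1 a :=
  (one_left a).symm

theorem mul_right (hl : ∀ a b, l b ≤ l (a * b)) (h : LcmUpTo l N a b a' b')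
    (h' : LcmUpTo l N b' c b'' c') : LcmUpTo l N a (b * c) (a' * b'') c' := by
  intro u v hN e
  rw [mul_assoc] at e
  obtain ⟨w, hu, hv⟩ := h u (c * v) hN e
  obtain ⟨w', hw, hv'⟩ := h' w v (by
    rw [← hv]; exact (hl b _).trans (e ▸ hN)) hv.symm
  exact ⟨w', by rw [hu, hw, mul_assoc], hv'⟩

theorem mul_left (hl : ∀ a b, l b ≤ l (a * b)) (h : LcmUpTo l N a b a' b')
    (h' : LcmUpTo l N c a' c' a'') : LcmUpTo l N (a * c) b c' (b' * a'') :=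
  (mul_right hl h.symm h'.symm).symm

end LcmUpTo

/-- Every defining relation is trivial or of the form `x * C x y = y * C y x`. -/
structure IsComplement (r : FreeMonoid α → FreeMonoid α → Prop) (C : α → α → FreeMonoid α) :
    Prop where
  self (x : α) : C x x = 1
  length {a b} : r a b → a.length = b.length
  rel {a b} : r a b →
    a = b ∨ ∃ x y, a = FreeMonoid.of x * C x y ∧ b = FreeMonoid.of y * C y x

/-- The class of a generator in the presented monoid. -/
def genClass (r : FreeMonoid α → FreeMonoid α → Prop) (x : α) : (conGen r).Quotient :=
  (conGen r).mk' (FreeMonoid.of x)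

/-- The word length on a homogeneously presented monoid. -/
def presentedLength (hr : IsComplement r C) : (conGen r).Quotient →* Multiplicative ℕ :=
  (conGen r).lift
    { toFun := fun a => Multiplicative.ofAdd a.length
      map_one' := rfl
      map_mul' := fun a b => by rw [FreeMonoid.length_mul]; rfl }
    (Con.conGen_le.2 fun _ _ h => congrArg Multiplicative.ofAdd (hr.length h))

/-- The word length, as a natural number. -/
def len (hr : IsComplement r C) (a : (conGen r).Quotient) : ℕ :=
  (presentedLength hr a).toAdd

theorem len_mk (hr : IsComplement r C) (a : FreeMonoid α) :
    len hr ((conGen r).mk' a) = a.length := rfl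

theorem len_mul (hr : IsComplement r C) (a b : (conGen r).Quotient) :
    len hr (a * b) = len hr a + len hr b := by
  simp [len]

theorem len_le_mul (hr : IsComplement r C) (a b : (conGen r).Quotient) :
    len hr b ≤ len hr (a * b) := by
  simp [len_mul]

theorem len_genClass (hr : IsComplement r C) (x : α) : len hr (genClass r x) = 1 := rfl

/-- The class of `C x y` in the presented monoid. -/
def compClass (r : FreeMonoid α → FreeMonoid α → Prop) (C : α → α → FreeMonoid α) (x y : α) :
    (conGen r).Quotient :=
  (conGen r).mk' (C x y)

/-- Generators have the least common multiples prescribed by `C`, up to length `N`. -/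
def GenLcm (hr : IsComplement r C) (N : ℕ) : Prop :=
  ∀ x y, LcmUpTo (len hr) N (genClass r x) (genClass r y) (compClass r C x y) (compClass r C y x)

/-- The cube condition at the triple `(x, z, y)` with middle term `z`, relative to the least
common multiples known up to length `N`. -/
def Cube (hr : IsComplement r C) (N : ℕ) (x z y : α) : Prop :=
  ∃ A B s, LcmUpTo (len hr) N (compClass r C z x) (compClass r C z y) A B ∧
    compClass r C x z * A = compClass r C x y * s ∧
    compClass r C y z * B = compClass r C y x * s

theorem Cube.symm {hr : IsComplement r C} {N : ℕ} {x z y : α} (h : Cube hr N x z y) :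
    Cube hr N y z x := by
  obtain ⟨A, B, s, h, hA, hB⟩ := h
  exact ⟨B, A, s, h.symm, hB, hA⟩

theorem Cube.intro {hr : IsComplement r C} {N : ℕ} {x z y : α} {a b A B : (conGen r).Quotient}
    (s : (conGen r).Quotient) (ha : compClass r C z x = a) (hb : compClass r C z y = b)
    (h : LcmUpTo (len hr) N a b A B) (hA : compClass r C x z * A = compClass r C x y * s)
    (hB : compClass r C y z * B = compClass r C y x * s) : Cube hr N x z y :=
  ⟨A, B, s, by rwa [ha, hb], hA, hB⟩

theorem compClass_self (hr : IsComplement r C) (x : α) : compClass r C x x = 1 := by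
  rw [compClass, hr.self, map_one]

theorem GenLcm.self {hr : IsComplement r C} {N : ℕ} (h : GenLcm hr N) (a : FreeMonoid α) :
    LcmUpTo (len hr) N ((conGen r).mk' a) ((conGen r).mk' a) 1 1 := by
  induction a using FreeMonoid.inductionOn' with
  | one => exact LcmUpTo.one_left 1
  | of_mul x a ih =>
    intro u v hl e
    simp only [map_mul, mul_assoc] at hl e
    obtain ⟨w, hu, hv⟩ := h x x _ _ hl e
    rw [compClass_self hr, one_mul] at hu hv
    exact ih u v ((len_le_mul hr _ _).trans hl) (hu.trans hv.symm)

theorem cube_of_distinct (hr : IsComplement r C) {N : ℕ} (h : GenLcm hr N)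
    (hc : ∀ x z y, x ≠ z → y ≠ z → x ≠ y → Cube hr N x z y) (x z y : α) : Cube hr N x z y := by
  by_cases hxz : x = z
  · subst hxz
    refine ⟨compClass r C x y, 1, 1, ?_, ?_, ?_⟩
    · rw [compClass_self hr]; exact LcmUpTo.one_left _
    · rw [compClass_self hr, one_mul, mul_one]
    · rfl
  by_cases hyz : y = z
  · subst hyz
    refine ⟨1, compClass r C y x, 1, ?_, ?_, ?_⟩
    · rw [compClass_self hr]; exact LcmUpTo.one_right _
    · rfl
    · rw [compClass_self hr, one_mul, mul_one]
  by_cases hxy : x = y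
  · subst hxy
    exact ⟨1, 1, compClass r C x z, h.self _, by simp [compClass_self hr],
      by simp [compClass_self hr]⟩
  exact hc x z y hxz hyz hxy

theorem genLcm_succ (hr : IsComplement r C) {N : ℕ}
    (hc : ∀ x z y, Cube hr N x z y) : GenLcm hr (N + 1) := by
  let E (a b : FreeMonoid α) : Prop := ∀ x a', a = FreeMonoid.of x * a' →
    ∃ y b' w, b = FreeMonoid.of y * b' ∧ (conGen r).mk' a' = compClass r C x y * w ∧
      (conGen r).mk' b' = compClass r C y x * w
  have key : ∀ a b, ConGen.Rel r a b → (conGen r).mk' a = (conGen r).mk' b ∧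
      (a.length ≤ N + 1 → E a b ∧ E b a) := by
    have hrefl : ∀ a, E a a := fun a x a' h =>
      ⟨x, a', (conGen r).mk' a', h, by simp [compClass_self hr], by simp [compClass_self hr]⟩
    have hof : ∀ x y, E (FreeMonoid.of x * C x y) (FreeMonoid.of y * C y x) := by
      intro x y x' a' h
      obtain ⟨rfl, rfl⟩ := List.cons.inj h
      exact ⟨y, C y x, 1, rfl, (mul_one _).symm, (mul_one _).symm⟩
    have htrans : ∀ a b c, a.length ≤ N + 1 → (conGen r).mk' a = (conGen r).mk' b →
        E a b → E b c → E a c := by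
      intro a b c hl hab h₁ h₂ x a' ha
      obtain ⟨z, b', p, hb, hap, hbp⟩ := h₁ x a' ha
      obtain ⟨y, c', q, hc', hbq, hcq⟩ := h₂ z b' hb
      obtain ⟨A, B, s, hL, hA, hB⟩ := hc x z y
      obtain ⟨w, rfl, rfl⟩ := hL p q (by
        have := congrArg (len hr) hab
        rw [len_mk, len_mk, hb, FreeMonoid.length_mul, FreeMonoid.length_of] at this
        rw [← hbp, len_mk]; omega) (hbp.symm.trans hbq)
      refine ⟨y, c', s * w, hc', ?_, ?_⟩
      · rw [hap, ← mul_assoc, hA, mul_assoc]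
      · rw [hcq, ← mul_assoc, hB, mul_assoc]
    have hmul : ∀ a b c d, (conGen r).mk' c = (conGen r).mk' d → a.length = b.length →
        E a b → E c d → E (a * c) (b * d) := by
      intro a b c d hcd hab h₁ h₂ x e he
      cases a using FreeMonoid.casesOn with
      | one =>
        obtain rfl : b = 1 := by
          rw [← FreeMonoid.length_eq_zero, ← hab]; rfl
        simpa using h₂ x e (by simpa using he)
      | of_mul x' a' =>
        rw [mul_assoc] at he
        obtain ⟨rfl, rfl⟩ := List.cons.inj he
        obtain ⟨y, b', w, rfl, ha, hb⟩ := h₁ _ a' rfl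
        refine ⟨y, b' * d, w * (conGen r).mk' c, mul_assoc _ _ _, ?_, ?_⟩
        · rw [← mul_assoc, ← ha, ← map_mul]; rfl
        · rw [← mul_assoc, ← hb, map_mul, hcd]
    have hlen : ∀ a b, (conGen r).mk' a = (conGen r).mk' b → a.length = b.length :=
      fun a b h => by rw [← len_mk hr, h, len_mk]
    intro a b h
    induction h with
    | of a b h =>
      refine ⟨(Con.eq _).2 (ConGen.Rel.of _ _ h), fun _ => ?_⟩
      rcases hr.rel h with rfl | ⟨x, y, rfl, rfl⟩
      · exact ⟨hrefl _, hrefl _⟩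
      · exact ⟨hof x y, hof y x⟩
    | refl a => exact ⟨rfl, fun _ => ⟨hrefl a, hrefl a⟩⟩
    | symm _ ih =>
      exact ⟨ih.1.symm, fun hl => (ih.2 ((hlen _ _ ih.1).le.trans hl)).symm⟩
    | trans _ _ ih₁ ih₂ =>
      refine ⟨ih₁.1.trans ih₂.1, fun hl => ?_⟩
      have hl₂ := (hlen _ _ ih₁.1).ge.trans hl
      have hl₃ := (hlen _ _ ih₂.1).ge.trans hl₂
      exact ⟨htrans _ _ _ hl ih₁.1 (ih₁.2 hl).1 (ih₂.2 hl₂).1,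
        htrans _ _ _ hl₃ ih₂.1.symm (ih₂.2 hl₂).2 (ih₁.2 hl).2⟩
    | mul _ _ ih₁ ih₂ =>
      refine ⟨by rw [map_mul, map_mul, ih₁.1, ih₂.1], fun hl => ?_⟩
      rw [FreeMonoid.length_mul] at hl
      obtain ⟨h₁, h₁'⟩ := ih₁.2 (by omega)
      obtain ⟨h₂, h₂'⟩ := ih₂.2 (by omega)
      exact ⟨hmul _ _ _ _ ih₂.1 (hlen _ _ ih₁.1) h₁ h₂,
        hmul _ _ _ _ ih₂.1.symm (hlen _ _ ih₁.1).symm h₁' h₂'⟩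
  intro x y u v hl e
  obtain ⟨a, rfl⟩ := (conGen r).mk'_surjective u
  obtain ⟨b, rfl⟩ := (conGen r).mk'_surjective v
  rw [genClass, genClass, ← map_mul, ← map_mul] at e
  obtain ⟨y', b', w, hb, h₁, h₂⟩ := ((key _ _ ((Con.eq _).1 e)).2 hl).1 x a rfl
  obtain ⟨rfl, rfl⟩ := List.cons.inj hb
  exact ⟨w, h₁, h₂⟩

/-- A homogeneous complemented presentation satisfying the cube condition on triples of distinct
generators defines a left cancellative monoid. -/
theorem mul_left_cancel_of_cube (hr : IsComplement r C)
    (hc : ∀ N, GenLcm hr N → ∀ x z y, x ≠ z → y ≠ z → x ≠ y → Cube hr N x z y)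
    (a b c : (conGen r).Quotient) (h : a * b = a * c) : b = c := by
  have hN : ∀ N, GenLcm hr N := by
    intro N
    induction N with
    | zero =>
      intro x y u v hl
      rw [len_mul, len_genClass] at hl
      omega
    | succ N ih => exact genLcm_succ hr (cube_of_distinct hr ih (hc N ih))
  obtain ⟨a, rfl⟩ := (conGen r).mk'_surjective a
  obtain ⟨w, rfl, rfl⟩ := (hN _).self a b c le_rfl h
  rfl

section Cubes

variable {hr : IsComplement r C} {N : ℕ} {x y z : α}

/-- The generators `x` and `y` commute, and `C` records it. -/
structure CommPair (r : FreeMonoid α → FreeMonoid α → Prop) (C : α → α → FreeMonoid α)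
    (x y : α) : Prop where
  left : compClass r C x y = genClass r y
  right : compClass r C y x = genClass r x
  eq : genClass r x * genClass r y = genClass r y * genClass r x

/-- The generators `x` and `y` satisfy the braid relation, and `C` records it. -/
structure BraidPair (r : FreeMonoid α → FreeMonoid α → Prop) (C : α → α → FreeMonoid α)
    (x y : α) : Prop where
  left : compClass r C x y = genClass r y * genClass r x
  right : compClass r C y x = genClass r x * genClass r y
  eq : genClass r x * genClass r y * genClass r x = genClass r y * genClass r x * genClass r y

theorem CommPair.symm (h : CommPair r C x y) : CommPair r C y x := ⟨h.2, h.1, h.3.symm⟩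

theorem BraidPair.symm (h : BraidPair r C x y) : BraidPair r C y x := ⟨h.2, h.1, h.3.symm⟩

theorem GenLcm.comm (hN : GenLcm hr N) (h : CommPair r C x y) :
    LcmUpTo (len hr) N (genClass r x) (genClass r y) (genClass r y) (genClass r x) := by
  simpa only [h.left, h.right] using hN x y

theorem GenLcm.braid (hN : GenLcm hr N) (h : BraidPair r C x y) :
    LcmUpTo (len hr) N (genClass r x) (genClass r y) (genClass r y * genClass r x)
      (genClass r x * genClass r y) := by
  simpa only [h.left, h.right] using hN x y

theorem GenLcm.gen_mul (hN : GenLcm hr N) (x : α) {a b a' b' : (conGen r).Quotient}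
    (h : LcmUpTo (len hr) N a b a' b') :
    LcmUpTo (len hr) N (genClass r x * a) (genClass r x * b) a' b' := by
  intro u v hl e
  simp only [mul_assoc] at hl e
  obtain ⟨w, hu, hv⟩ := hN x x _ _ hl e
  rw [compClass_self hr, one_mul] at hu hv
  exact h u v ((len_le_mul hr _ _).trans hl) (hu.trans hv.symm)

theorem cube_comm_comm_comm (hN : GenLcm hr N) (hxz : CommPair r C x z) (hyz : CommPair r C y z)
    (hxy : CommPair r C x y) : Cube hr N x z y := by
  refine .intro (genClass r z) hxz.right hyz.right (hN.comm hxy) ?_ ?_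
  · rw [hxz.left, hxy.left, hyz.eq]
  · rw [hyz.left, hxy.right, hxz.eq]

theorem cube_comm_comm_braid (hN : GenLcm hr N) (hxz : CommPair r C x z) (hyz : CommPair r C y z)
    (hxy : BraidPair r C x y) : Cube hr N x z y := by
  refine .intro (genClass r z) hxz.right hyz.right (hN.braid hxy) ?_ ?_
  · rw [hxz.left, hxy.left]; exact (Commute.mul_left hyz.eq hxz.eq).eq.symm
  · rw [hyz.left, hxy.right]; exact (Commute.mul_left hxz.eq hyz.eq).eq.symm

theorem cube_braid_comm_comm (hN : GenLcm hr N) (hxz : BraidPair r C x z) (hyz : CommPair r C y z)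
    (hxy : CommPair r C x y) : Cube hr N x z y := by
  refine .intro (genClass r z * genClass r x) hxz.right hyz.right
    ((hN.comm hxy).mul_left (len_le_mul hr) (hN.comm hyz.symm)) ?_ ?_
  · rw [hxz.left, hxy.left]; exact (Commute.mul_left hyz.eq.symm hxy.eq).eq
  · rw [hyz.left, hxy.right]; simpa only [mul_assoc] using hxz.eq.symm

theorem cube_braid_braid_comm (hN : GenLcm hr N) (hxz : BraidPair r C x z)
    (hyz : BraidPair r C y z) (hxy : CommPair r C x y) : Cube hr N x z y := by
  have hl := len_le_mul hr
  refine .intro (genClass r z * genClass r y * genClass r x * genClass r z) hxz.right hyz.right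
    (((hN.comm hxy).mul_right hl (hN.braid hxz)).mul_left hl
      ((hN.braid hyz.symm).mul_right hl (hN.gen_mul z (hN.comm hxy.symm)))) ?_ ?_
  · rw [hxz.left, hxy.left]; exact word_braid_center hxz.eq hyz.eq hxy.eq
  · rw [hyz.left, hxy.right]; rw [word_braid_center hyz.eq hxz.eq hxy.eq.symm]
    simp only [mul_assoc, comm_mul hxy.eq]

theorem cube_braid_comm_braid (hN : GenLcm hr N) (hxz : BraidPair r C x z)
    (hyz : CommPair r C y z) (hxy : BraidPair r C x y) : Cube hr N x z y := by
  have hl := len_le_mul hr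
  refine .intro (genClass r z * genClass r x * genClass r y) hxz.right hyz.right
    ((hN.braid hxy).mul_left hl ((hN.comm hyz.symm).mul_right hl (hN.braid hxz.symm))) ?_ ?_
  · rw [hxz.left, hxy.left]; exact word_braid_end_left hxz.eq hyz.eq hxy.eq
  · rw [hyz.left, hxy.right]; exact word_braid_end_right hxz.eq hyz.eq hxy.eq

end Cubes

end Complement

section BMon

variable {n : ℕ} {k : ℤ}

/-- The position of a generator on the type `A` diagram obtained by merging all the `t̃_i`. -/
def level : Gen n → ℕ
  | .inl _ => 2
  | .inr j => j.val

/-- The adjacency of positions on the type `A` diagram. -/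
abbrev AdjLevel (x y : Gen n) : Prop := level x + 1 = level y ∨ level y + 1 = level x

/-- The complement of `t̃_i` in the common value of the products `t̃_j t̃_{j-k}`. -/
def shift (k : ℤ) : Gen n → FreeMonoid (Gen n)
  | .inl i => tw n (i - k)
  | .inr _ => 1

/-- The right complement read off from the defining relations. -/
def comp (n : ℕ) (k : ℤ) (x y : Gen n) : FreeMonoid (Gen n) :=
  if x = y then 1 else if level x = level y then shift k x else
    if AdjLevel x y then FreeMonoid.of y * FreeMonoid.of x else FreeMonoid.of y

theorem comp_of_adj {x y : Gen n} (h : AdjLevel x y) :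
    comp n k x y = FreeMonoid.of y * FreeMonoid.of x := by
  have h₁ : level x ≠ level y := by omega
  have h₂ : x ≠ y := fun e => h₁ (congrArg _ e)
  rw [comp, if_neg h₂, if_neg h₁, if_pos h]

theorem comp_of_not_adj {x y : Gen n} (h₁ : level x ≠ level y) (h : ¬ AdjLevel x y) :
    comp n k x y = FreeMonoid.of y := by
  have h₂ : x ≠ y := fun e => h₁ (congrArg _ e)
  rw [comp, if_neg h₂, if_neg h₁, if_neg h]

theorem comp_inl {i j : ℤ} (h : i ≠ j) : comp n k (.inl i) (.inl j) = tw n (i - k) := by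
  rw [comp, if_neg (by simpa using h)]
  simp [level, shift]

theorem isComplement_comp (n : ℕ) (k : ℤ) : IsComplement (BRel n k) (comp n k) where
  self x := if_pos rfl
  length h := by cases h <;> rfl
  rel h := by
    have hadj : ∀ {x y : Gen n}, AdjLevel x y →
        FreeMonoid.of x * FreeMonoid.of y * FreeMonoid.of x =
          FreeMonoid.of x * comp n k x y := fun h => by
      rw [comp_of_adj h, mul_assoc]
    have hcomm : ∀ {x y : Gen n}, level x ≠ level y → ¬ AdjLevel x y →
        FreeMonoid.of x * FreeMonoid.of y = FreeMonoid.of x * comp n k x y := fun h h' => by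
      rw [comp_of_not_adj h h']
    cases h with
    | braid i j h => exact .inr ⟨.inr i, .inr j, hadj h, hadj h.symm⟩
    | comm i j h =>
      refine .inr ⟨.inr i, .inr j, hcomm ?_ ?_, hcomm ?_ ?_⟩ <;> simp only [AdjLevel, level] <;>
        omega
    | ts3 i s h =>
      refine .inr ⟨.inr s, .inl i, hadj ?_, hadj ?_⟩ <;> simp only [AdjLevel, level] <;> omega
    | tsj i s h =>
      refine .inr ⟨.inr s, .inl i, hcomm ?_ ?_, hcomm ?_ ?_⟩ <;> simp only [AdjLevel, level] <;>
        omega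
    | tt i j =>
      by_cases hij : i = j
      · exact .inl (by rw [hij])
      · exact .inr ⟨.inl i, .inl j, by rw [comp_inl hij]; rfl, by rw [comp_inl (Ne.symm hij)]; rfl⟩

theorem mk_eq_of_rel {a b : FreeMonoid (Gen n)} (h : BRel n k a b) :
    (conGen (BRel n k)).mk' a = (conGen (BRel n k)).mk' b :=
  (Con.eq _).2 (ConGen.Rel.of _ _ h)

theorem braidPair {x y : Gen n} (h : AdjLevel x y) : BraidPair (BRel n k) (comp n k) x y := by
  refine ⟨congrArg _ (comp_of_adj h), congrArg _ (comp_of_adj h.symm), ?_⟩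
  rcases x with i | i <;> rcases y with j | j <;> simp only [AdjLevel, level] at h
  · omega
  · exact (mk_eq_of_rel (.ts3 i j (by omega))).symm
  · exact mk_eq_of_rel (.ts3 j i (by omega))
  · exact mk_eq_of_rel (.braid i j h)

theorem commPair {x y : Gen n} (h₁ : level x ≠ level y) (h : ¬ AdjLevel x y) :
    CommPair (BRel n k) (comp n k) x y := by
  refine ⟨congrArg _ (comp_of_not_adj h₁ h),
    congrArg _ (comp_of_not_adj h₁.symm fun h' => h h'.symm), ?_⟩
  rcases x with i | i <;> rcases y with j | j <;> simp only [AdjLevel, level] at h h₁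
  · omega
  · exact (mk_eq_of_rel (.tsj i j (by have := j.2; omega))).symm
  · exact mk_eq_of_rel (.tsj j i (by have := i.2; omega))
  · exact mk_eq_of_rel (.comm i j (by omega))

theorem genClass_mul_genClass (i j : ℤ) :
    genClass (BRel n k) (.inl i) * genClass (BRel n k) (.inl (i - k)) =
      genClass (BRel n k) (.inl j) * genClass (BRel n k) (.inl (j - k)) :=
  mk_eq_of_rel (.tt i j)

theorem compClass_inl {i j : ℤ} (h : i ≠ j) :
    compClass (BRel n k) (comp n k) (.inl i) (.inl j) = genClass (BRel n k) (.inl (i - k)) :=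
  congrArg _ (comp_inl h)

theorem GenLcm.inl {N : ℕ} (hN : GenLcm (isComplement_comp n k) N) {i j : ℤ} (h : i ≠ j) :
    LcmUpTo (len (isComplement_comp n k)) N (genClass (BRel n k) (.inl i))
      (genClass (BRel n k) (.inl j)) (genClass (BRel n k) (.inl (i - k)))
      (genClass (BRel n k) (.inl (j - k))) := by
  simpa only [compClass_inl h, compClass_inl h.symm] using hN (.inl i) (.inl j)

theorem cube_of_level_ne {N : ℕ} (hN : GenLcm (isComplement_comp n k) N) {x y z : Gen n}
    (hxz : level x ≠ level z) (hyz : level y ≠ level z) (hxy : level x ≠ level y) :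
    Cube (isComplement_comp n k) N x z y := by
  by_cases h₁ : AdjLevel x z <;> by_cases h₂ : AdjLevel y z <;> by_cases h₃ : AdjLevel x y
  · omega
  · exact cube_braid_braid_comm hN (braidPair h₁) (braidPair h₂) (commPair hxy h₃)
  · exact cube_braid_comm_braid hN (braidPair h₁) (commPair hyz h₂) (braidPair h₃)
  · exact cube_braid_comm_comm hN (braidPair h₁) (commPair hyz h₂) (commPair hxy h₃)
  · exact (cube_braid_comm_braid hN (braidPair h₂) (commPair hxz h₁) (braidPair h₃).symm).symm
  · exact (cube_braid_comm_comm hN (braidPair h₂) (commPair hxz h₁) (commPair hxy h₃).symm).symm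
  · exact cube_comm_comm_braid hN (commPair hxz h₁) (commPair hyz h₂) (braidPair h₃)
  · exact cube_comm_comm_comm hN (commPair hxz h₁) (commPair hyz h₂) (commPair hxy h₃)

theorem cube_inl_inl_inl {N : ℕ} (hN : GenLcm (isComplement_comp n k) N) {i j l : ℤ}
    (hil : i ≠ l) (hjl : j ≠ l) (hij : i ≠ j) :
    Cube (isComplement_comp n k) N (.inl i) (.inl l) (.inl j) :=
  .intro 1 (compClass_inl hil.symm) (compClass_inl hjl.symm) (hN.self _)
    (by rw [compClass_inl hil, compClass_inl hij]) (by rw [compClass_inl hjl, compClass_inl hij.symm])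

theorem cube_inl_inr_inl {N : ℕ} (hN : GenLcm (isComplement_comp n k) N) {i j : ℤ} (s : SIdx n)
    (hij : i ≠ j) : Cube (isComplement_comp n k) N (.inl i) (.inr s) (.inl j) := by
  have hl := len_le_mul (isComplement_comp n k)
  by_cases hs : s.val = 3
  · have hb (m : ℤ) : BraidPair (BRel n k) (comp n k) (.inl m) (.inr s) := braidPair (.inl hs.symm)
    have hij' : i - k ≠ j - k := by omega
    refine .intro (genClass _ (.inr s) * (genClass _ (.inl i) * genClass _ (.inl (i - k))) *
      genClass _ (.inr s)) (hb i).right (hb j).right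
      (((hN.inl hij).mul_right hl (hN.braid (hb _))).mul_left hl
        ((hN.braid (hb _).symm).mul_right hl (hN.gen_mul _ (hN.inl hij')))) ?_ ?_
    · rw [(hb i).left, compClass_inl hij]
      exact word_twisted_braid (genClass_mul_genClass _ _) (hb _).eq (hb _).eq
    · rw [(hb j).left, compClass_inl hij.symm, genClass_mul_genClass i j]
      exact word_twisted_braid (genClass_mul_genClass _ _) (hb _).eq (hb _).eq
  · have hc (m : ℤ) : CommPair (BRel n k) (comp n k) (.inl m) (.inr s) := by
      have := s.2
      apply commPair <;> simp only [AdjLevel, level] <;> omega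
    refine .intro (genClass _ (.inr s)) (hc i).right (hc j).right (hN.inl hij) ?_ ?_
    · rw [(hc i).left, compClass_inl hij, (hc _).eq]
    · rw [(hc j).left, compClass_inl hij.symm, (hc _).eq]

theorem cube_inl_inl_inr {N : ℕ} (hk : k ≠ 0) (hN : GenLcm (isComplement_comp n k) N) {i l : ℤ}
    (s : SIdx n) (hil : i ≠ l) : Cube (isComplement_comp n k) N (.inl i) (.inl l) (.inr s) := by
  have hl := len_le_mul (isComplement_comp n k)
  by_cases hs : s.val = 3
  · have hb (m : ℤ) : BraidPair (BRel n k) (comp n k) (.inl m) (.inr s) := braidPair (.inl hs.symm)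
    have hlk : l - k ≠ l := by omega
    refine .intro (genClass _ (.inl (i - k)) * genClass _ (.inr s) * genClass _ (.inl (i - k - k)))
      (compClass_inl hil.symm) (hb l).left
      ((hN.braid (hb _)).mul_right hl ((hN.inl hlk).mul_left hl (hN.braid (hb _).symm))) ?_ ?_
    · rw [(hb i).left, compClass_inl hil,
        word_twisted_braid (genClass_mul_genClass _ _) (hb _).eq (hb _).eq,
        genClass_mul_genClass i (l - k)]
      simp only [mul_assoc]
    · rw [(hb l).right, (hb i).right, ← mul_assoc (genClass _ (Sum.inl (l - k))),
        word_twisted_square (genClass_mul_genClass _ _) (hb _).eq,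
        word_twisted_square (genClass_mul_genClass _ _) (hb _).eq, genClass_mul_genClass l i]
  · have hc (m : ℤ) : CommPair (BRel n k) (comp n k) (.inl m) (.inr s) := by
      have := s.2
      apply commPair <;> simp only [AdjLevel, level] <;> omega
    refine .intro (genClass _ (.inl (i - k))) (compClass_inl hil.symm) (hc l).left
      (hN.comm (hc _)) ?_ ?_
    · rw [(hc i).left, compClass_inl hil, (hc _).eq]
    · rw [(hc l).right, (hc i).right, genClass_mul_genClass l i]

theorem BMon.mul_left_cancel (hk : k ≠ 0) (a b c : BMon n k) (h : a * b = a * c) : b = c := by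
  refine mul_left_cancel_of_cube (isComplement_comp n k) ?_ a b c h
  intro N hN x z y hxz hyz hxy
  have inr_ne {i j : SIdx n} (h : (Sum.inr i : Gen n) ≠ .inr j) :
      level (.inr i : Gen n) ≠ level (.inr j : Gen n) := fun e => h (congrArg _ (Subtype.ext e))
  have inl_ne (i : ℤ) (j : SIdx n) : level (.inl i : Gen n) ≠ level (.inr j : Gen n) := by
    have := j.2
    simp only [level]; omega
  have ne_of {i j : ℤ} (h : (Sum.inl i : Gen n) ≠ .inl j) : i ≠ j := fun e => h (congrArg _ e)
  rcases x with x | x <;> rcases z with z | z <;> rcases y with y | y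
  · exact cube_inl_inl_inl hN (ne_of hxz) (ne_of hyz) (ne_of hxy)
  · exact cube_inl_inl_inr hk hN y (ne_of hxz)
  · exact cube_inl_inr_inl hN z (ne_of hxy)
  · exact cube_of_level_ne hN (inl_ne _ _) (inr_ne hyz) (inl_ne _ _)
  · exact (cube_inl_inl_inr hk hN x (ne_of hyz)).symm
  · exact cube_of_level_ne hN (inl_ne _ _).symm (inl_ne _ _).symm (inr_ne hxy)
  · exact cube_of_level_ne hN (inr_ne hxz) (inl_ne _ _) (inl_ne _ _).symm
  · exact cube_of_level_ne hN (inr_ne hxz) (inr_ne hyz) (inr_ne hxy)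

/-- The involution `t̃_i ↦ t̃_{-i}`, `s̃_j ↦ s̃_j` of the generators. -/
def flipGen : Gen n → Gen n
  | .inl i => .inl (-i)
  | .inr j => .inr j

/-- The map to the opposite monoid induced by `flipGen`. -/
def flipHom (n : ℕ) (k : ℤ) : BMon n k →* (BMon n k)ᵐᵒᵖ :=
  (conGen (BRel n k)).lift
    (FreeMonoid.lift fun x => MulOpposite.op (genClass (BRel n k) (flipGen x)))
    (Con.conGen_le.2 fun a b h => by
      rw [Con.ker_apply]
      cases h <;> simp only [map_mul, tw, sw, FreeMonoid.lift_eval_of, ← MulOpposite.op_mul,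
        ← mul_assoc] <;> refine congrArg MulOpposite.op ?_
      case braid i j h => exact (braidPair (x := .inr i) (y := .inr j) h).eq
      case comm i j h => exact (mk_eq_of_rel (.comm i j h)).symm
      case ts3 i s h => exact mk_eq_of_rel (.ts3 (-i) s h)
      case tsj i s h => exact (mk_eq_of_rel (.tsj (-i) s h)).symm
      case tt i j =>
        have h := genClass_mul_genClass (n := n) (k := k) (-(i - k)) (-(j - k))
        rwa [show -(i - k) - k = -i by ring, show -(j - k) - k = -j by ring] at h)

theorem unop_flipHom_unop_flipHom (a : BMon n k) :
    (flipHom n k (flipHom n k a).unop).unop = a := by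
  obtain ⟨a, rfl⟩ := (conGen (BRel n k)).mk'_surjective a
  induction a using FreeMonoid.inductionOn' with
  | one => simp
  | of_mul x a ih =>
    rw [map_mul, map_mul, MulOpposite.unop_mul, map_mul, MulOpposite.unop_mul, ih]
    congr 1
    change genClass (BRel n k) (flipGen (flipGen x)) = genClass (BRel n k) x
    rcases x with i | j
    · simp only [flipGen, neg_neg]
    · rfl

theorem BMon.mul_right_cancel (hk : k ≠ 0) (a b c : BMon n k) (h : b * a = c * a) : b = c := by
  have h' := congrArg (fun x => (flipHom n k x).unop) h
  simp only [map_mul, MulOpposite.unop_mul] at h'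
  have := congrArg (fun x => (flipHom n k x).unop) (BMon.mul_left_cancel hk _ _ _ h')
  simpa only [unop_flipHom_unop_flipHom] using this

end BMon

/-- the monoid `B^{⊕k}(∞,∞,n)` is (left and right) cancellative. -/
theorem stmt_9 (n : ℕ) (hn : 2 ≤ n) (k : ℤ) (hk : k ≠ 0)
    (a b c d : BMon n k) (h : a * b * d = a * c * d) : b = c := by
  exact BMon.mul_left_cancel hk a b c (BMon.mul_right_cancel hk d _ _ h)
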